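/- arXiv:1812.01794 — 3 statements merged into one kernel-verified Lean document; each statement's English description precedes it below -/
import Mathlib

section
/- Let n ≥ 1, 2 ≤ ℓ ≤ n be integers and let c be a positive integer with c ≥ 4n/(ℓ−1). Then the random variable X_S(n,c) := max{X_{(1),n}, Z_{(1),c}} stochastically dominates the random variable X_B(n,ℓ) := max{X_{(1),n}, W_{ℓ,n}}; that is, for every p ∈ [0,1], Pr[max{X_{(1),n}, Z_{(1),c}} > p] ≥ Pr[max{X_{(1),n}, W_{ℓ,n}} > p]. -/
open MeasureTheory Set

/-- The uniform distribution on `[0,1]`. -/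
noncomputable def unif : Measure ℝ := volume.restrict (Set.Icc 0 1)

instance : IsProbabilityMeasure unif := by
  constructor
  simp [unif, Real.volume_Icc]

/-- The `k`-th largest entry (1-indexed) of a tuple `x : Fin n → ℝ`. -/
noncomputable def kthLargest {n : ℕ} (x : Fin n → ℝ) (k : ℕ) : ℝ :=
  if h : n - k < n then x (Tuple.sort x ⟨n - k, h⟩) else 0

/-- Given the `n` draws `x` and an independent uniform `u ∈ [0,1]`, this is the random
variable `W_{ℓ,n}` which, conditioned on `x`, is uniform on `[X_{(ℓ),n}, 1]`. -/
noncomputable def Wvar {n : ℕ} (ℓ : ℕ) (x : Fin n → ℝ) (u : ℝ) : ℝ :=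
  kthLargest x ℓ + u * (1 - kthLargest x ℓ)

/-- The sample space for `n` i.i.d. uniforms `X`, the auxiliary uniform defining `W_{ℓ,n}`,
and `c` further i.i.d. uniforms `Z`, all independent. -/
noncomputable def P₀ (n c : ℕ) : Measure ((Fin n → ℝ) × ℝ × (Fin c → ℝ)) :=
  (Measure.pi fun _ : Fin n => unif).prod (unif.prod (Measure.pi fun _ : Fin c => unif))

lemma le_kth {n k : ℕ} (h1 : 1 ≤ k) (h2 : k ≤ n) (x : Fin n → ℝ) (t : ℝ) :
    t ≤ kthLargest x k ↔ k ≤ (Finset.univ.filter fun j => t ≤ x j).card := by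
  have h : n - k < n := by omega
  have hm : Monotone (x ∘ Tuple.sort x) := Tuple.monotone_sort x
  have hcard : (Finset.univ.filter fun j => t ≤ x j).card =
      (Finset.univ.filter fun j => t ≤ x (Tuple.sort x j)).card := by
    symm
    apply Finset.card_equiv (Tuple.sort x)
    intro j
    simp
  rw [hcard, kthLargest, dif_pos h]
  constructor
  · intro ht
    have hs : Finset.Ici (⟨n - k, h⟩ : Fin n) ⊆
        Finset.univ.filter fun j => t ≤ x (Tuple.sort x j) := by
      intro j hj
      simp only [Finset.mem_filter, Finset.mem_univ, true_and]
      exact ht.trans (hm (Finset.mem_Ici.1 hj))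
    have := Finset.card_le_card hs
    rw [Fin.card_Ici] at this
    simp only at this
    omega
  · intro hk
    by_contra hlt
    push Not at hlt
    have hs : (Finset.univ.filter fun j => t ≤ x (Tuple.sort x j)) ⊆
        Finset.Ioi (⟨n - k, h⟩ : Fin n) := by
      intro j hj
      simp only [Finset.mem_filter, Finset.mem_univ, true_and] at hj
      rw [Finset.mem_Ioi]
      by_contra hle
      push Not at hle
      have := hm hle
      simp only [Function.comp] at this
      linarith
    have := Finset.card_le_card hs
    rw [Fin.card_Ioi] at this
    simp only at this
    omega

lemma meas_kth {n k : ℕ} (h1 : 1 ≤ k) (h2 : k ≤ n) :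
    Measurable fun x : Fin n → ℝ => kthLargest x k := by
  apply measurable_of_Ici
  intro t
  have : (fun x : Fin n → ℝ => kthLargest x k) ⁻¹' Set.Ici t =
      (fun x : Fin n → ℝ => ∑ j, if t ≤ x j then 1 else 0) ⁻¹' (Set.Ici k) := by
    ext x
    simp only [Set.mem_preimage, Set.mem_Ici, le_kth h1 h2, Finset.card_filter]
  rw [this]
  refine (Finset.measurable_sum _ fun j _ => ?_) measurableSet_Ici
  exact Measurable.ite (measurableSet_le measurable_const (measurable_pi_apply j))
    measurable_const measurable_const

lemma kth_le {n k : ℕ} (h1 : 1 ≤ k) (h2 : k ≤ n) (x : Fin n → ℝ) (p : ℝ)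
    (hx : ∀ j, x j ≤ p) : kthLargest x k ≤ p := by
  have := (le_kth h1 h2 x (kthLargest x k)).1 le_rfl
  have hpos : 0 < (Finset.univ.filter fun j => kthLargest x k ≤ x j).card := by omega
  obtain ⟨j, hj⟩ := Finset.card_pos.1 hpos
  simp only [Finset.mem_filter, Finset.mem_univ, true_and] at hj
  exact hj.trans (hx j)

lemma le_kth_one {n : ℕ} (hn : 1 ≤ n) (x : Fin n → ℝ) (j : Fin n) :
    x j ≤ kthLargest x 1 := by
  rw [le_kth le_rfl hn, Nat.one_le_iff_ne_zero, ← Nat.pos_iff_ne_zero, Finset.card_pos]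
  exact ⟨j, by simp⟩

lemma count_top {n l : ℕ} (h1 : 2 ≤ l) (h2 : l ≤ n) (x : Fin n → ℝ) (p : ℝ) :
    l - 1 ≤ (Finset.univ.filter fun i =>
      kthLargest (Function.update x i p) l ≤ x i).card := by
  refine ((le_kth (by omega : 1 ≤ l - 1) (by omega) x _).1 le_rfl).trans (Finset.card_le_card ?_)
  intro i hi
  simp only [Finset.mem_filter, Finset.mem_univ, true_and] at hi ⊢
  by_contra hlt
  push Not at hlt
  have ha := (le_kth (by omega) h2 (Function.update x i p) _).1 le_rfl
  set R := kthLargest (Function.update x i p) l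
  have hb : ¬ (R ≤ kthLargest x (l - 1)) := by linarith
  rw [le_kth (by omega) (by omega)] at hb
  have hs : (Finset.univ.filter fun j => R ≤ Function.update x i p j) ⊆
      insert i (Finset.univ.filter fun j => R ≤ x j) := by
    intro j hj
    simp only [Finset.mem_filter, Finset.mem_univ, true_and, Finset.mem_insert] at hj ⊢
    by_cases hji : j = i
    · exact Or.inl hji
    · rw [Function.update_of_ne hji] at hj
      exact Or.inr hj
  have := (Finset.card_le_card hs).trans (Finset.card_insert_le _ _)
  omega

lemma lint_marg {m : ℕ} (ν : Measure ℝ) [SigmaFinite ν] (i : Fin (m + 1))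
    (f : (Fin (m + 1) → ℝ) → ENNReal) (hf : Measurable f) :
    ∫⁻ x, f x ∂(Measure.pi fun _ => ν) =
      ∫⁻ y, ∫⁻ u, f (i.insertNth u y) ∂ν ∂(Measure.pi fun _ : Fin m => ν) := by
  have h := (measurePreserving_piFinSuccAbove (fun _ : Fin (m + 1) => ν) i).symm
  rw [← h.lintegral_comp hf, lintegral_prod_symm]
  · rfl
  · exact (hf.comp h.measurable).aemeasurable

/-- the truncated uniform measure -/
noncomputable def nuP (p : ℝ) : Measure ℝ := volume.restrict (Set.Icc 0 p)

instance (p : ℝ) : IsFiniteMeasure (nuP p) := by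
  unfold nuP; infer_instance

lemma nuP_univ (p : ℝ) : nuP p Set.univ = ENNReal.ofReal p := by
  simp [nuP]

lemma pi_nuP_univ (p : ℝ) (n : ℕ) :
    (Measure.pi fun _ : Fin n => nuP p) Set.univ = ENNReal.ofReal p ^ n := by
  simp [Measure.pi_univ, nuP_univ]

lemma ae_box (p : ℝ) (n : ℕ) :
    ∀ᵐ x ∂(Measure.pi fun _ : Fin n => nuP p), ∀ j, 0 ≤ x j ∧ x j ≤ p := by
  rw [ae_all_iff]
  intro j
  have h : ∀ᵐ u ∂(nuP p), 0 ≤ u ∧ u ≤ p := by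
    have := ae_restrict_mem (μ := (volume : Measure ℝ)) (measurableSet_Icc (a := (0:ℝ)) (b := p))
    exact this
  exact (Measure.quasiMeasurePreserving_eval (μ := fun _ : Fin n => nuP p) j).ae h

lemma inv_moment {n l : ℕ} (h1 : 2 ≤ l) (h2 : l ≤ n) (p : ℝ) :
    ((l - 1 : ℕ) : ENNReal) * ∫⁻ x, (ENNReal.ofReal (p - kthLargest x l))⁻¹
      ∂(Measure.pi fun _ : Fin n => nuP p) ≤ n * ENNReal.ofReal p ^ (n - 1) := by
  obtain ⟨m, rfl⟩ : ∃ m, n = m + 1 := ⟨n - 1, by omega⟩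
  have hmk := meas_kth (by omega : 1 ≤ l) h2
  have hmu : ∀ i : Fin (m + 1), Measurable fun x : Fin (m + 1) → ℝ =>
      kthLargest (Function.update x i p) l := fun i =>
    hmk.comp (by fun_prop)
  let g : Fin (m + 1) → (Fin (m + 1) → ℝ) → ENNReal := fun i x =>
    if kthLargest (Function.update x i p) l ≤ x i then
      (ENNReal.ofReal (p - kthLargest (Function.update x i p) l))⁻¹ else 0
  have hg : ∀ i, Measurable (g i) := fun i =>
    Measurable.ite (measurableSet_le (hmu i) (measurable_pi_apply i))
      ((measurable_const.sub (hmu i)).ennreal_ofReal.inv) measurable_const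
  have hm1 : Measurable fun x : Fin (m + 1) → ℝ => (ENNReal.ofReal (p - kthLargest x l))⁻¹ :=
    (measurable_const.sub hmk).ennreal_ofReal.inv
  rw [← lintegral_const_mul _ hm1]
  calc _ ≤ ∫⁻ x, ∑ i, g i x ∂(Measure.pi fun _ : Fin (m + 1) => nuP p) := by
        apply lintegral_mono_ae
        filter_upwards [ae_box p (m + 1)] with x hx
        have hc := count_top h1 h2 x p
        rw [← Finset.sum_filter]
        calc _ ≤ ((Finset.univ.filter fun i =>
                kthLargest (Function.update x i p) l ≤ x i).card : ENNReal) *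
                (ENNReal.ofReal (p - kthLargest x l))⁻¹ := by
              gcongr
          _ = ∑ i ∈ Finset.univ.filter fun i =>
                kthLargest (Function.update x i p) l ≤ x i,
                (ENNReal.ofReal (p - kthLargest x l))⁻¹ := by
              rw [Finset.sum_const, nsmul_eq_mul]
          _ ≤ _ := by
              apply Finset.sum_le_sum
              intro i hi
              simp only [Finset.mem_filter, Finset.mem_univ, true_and] at hi
              have hxl : kthLargest x l ≤ kthLargest (Function.update x i p) l := by
                rw [le_kth (by omega) h2]
                refine ((le_kth (by omega) h2 x _).1 le_rfl).trans (Finset.card_le_card ?_)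
                intro j hj
                simp only [Finset.mem_filter, Finset.mem_univ, true_and] at hj ⊢
                by_cases hji : j = i
                · subst hji; simpa using hj.trans (hx j).2
                · rwa [Function.update_of_ne hji]
              gcongr
    _ = ∑ i, ∫⁻ x, g i x ∂(Measure.pi fun _ : Fin (m + 1) => nuP p) :=
        lintegral_finsetSum _ fun i _ => hg i
    _ ≤ ∑ i : Fin (m + 1), ENNReal.ofReal p ^ m := by
        apply Finset.sum_le_sum
        intro i _
        rw [lint_marg _ i _ (hg i)]
        calc _ ≤ ∫⁻ y, 1 ∂(Measure.pi fun _ : Fin m => nuP p) := by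
              apply lintegral_mono
              intro y
              simp only [g, Fin.update_insertNth, Fin.insertNth_apply_same]
              set R := kthLargest (i.insertNth p y : Fin (m + 1) → ℝ) l
              have : ∀ u : ℝ, (if R ≤ u then (ENNReal.ofReal (p - R))⁻¹ else 0) =
                  (Set.Ici R).indicator (fun _ => (ENNReal.ofReal (p - R))⁻¹) u := by
                intro u; simp [Set.indicator_apply]
              simp only [this]
              rw [lintegral_indicator_const measurableSet_Ici]
              calc _ ≤ (ENNReal.ofReal (p - R))⁻¹ * ENNReal.ofReal (p - R) := by
                    gcongr
                    rw [nuP, Measure.restrict_apply measurableSet_Ici, ← Real.volume_Icc]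
                    apply measure_mono
                    intro u hu
                    exact ⟨hu.1, hu.2.2⟩
                _ ≤ 1 := ENNReal.inv_mul_le_one _
          _ = _ := by simp [pi_nuP_univ]
    _ = _ := by simp

lemma real_ineq (p m : ℝ) (c : ℕ) (hp : 0 < p) (hp1 : p ≤ 1) (hm : 0 < m) (hc : 1 ≤ c)
    (hcm : m ≤ c) : p ^ c ≤ p / (p + (1 - p) * m) := by
  obtain ⟨d, rfl⟩ : ∃ d, c = d + 1 := ⟨c - 1, by omega⟩
  have hden : 0 < p + (1 - p) * m := by
    have := mul_nonneg (sub_nonneg.2 hp1) hm.le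
    linarith
  rw [pow_succ, mul_comm, le_div_iff₀ hden, mul_assoc]
  have key : p ^ d * (p + (1 - p) * m) ≤ 1 := by
    have hb : 1 + (d : ℝ) * (1 / p - 1) ≤ (1 / p) ^ d := by
      have := one_add_mul_le_pow (a := 1 / p - 1) (by
        have : 0 < 1 / p := by positivity
        linarith) d
      simpa using this
    have h2 : 1 - p ≤ 1 / p - 1 := by
      rw [le_sub_iff_add_le, le_div_iff₀ hp]; nlinarith [sq_nonneg (p - 1)]
    have h3 : p + (1 - p) * m ≤ (1 / p) ^ d := by
      push_cast at hcm
      have : (d : ℝ) * (1 - p) ≤ d * (1 / p - 1) := by gcongr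
      nlinarith
    calc _ ≤ p ^ d * (1 / p) ^ d := by gcongr
      _ = 1 := by rw [← mul_pow]; simp [hp.ne']
  nlinarith

lemma main_int {n l c : ℕ} (h1 : 2 ≤ l) (h2 : l ≤ n) (hc : 1 ≤ c)
    (hcb : (n : ℝ) / ((l : ℝ) - 1) ≤ c) (p : ℝ) (hp : 0 < p) (hp1 : p < 1) :
    ENNReal.ofReal p ^ (n + c) ≤
      ∫⁻ x, ENNReal.ofReal ((p - kthLargest x l) / (1 - kthLargest x l))
        ∂(Measure.pi fun _ : Fin n => nuP p) := by
  have hmk := meas_kth (by omega : 1 ≤ l) h2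
  have hl : (0 : ℝ) < (l : ℝ) - 1 := by
    have : (2 : ℝ) ≤ l := by exact_mod_cast h1
    linarith
  have hn : (0 : ℝ) < n := by exact_mod_cast (by omega : 0 < n)
  set M : ℝ := (n : ℝ) / ((l : ℝ) - 1) with hM
  have hM0 : 0 < M := by positivity
  have hq : 0 < 1 - p := by linarith
  have hden : 0 < p + (1 - p) * M := by positivity
  set a : ℝ := p / (p + (1 - p) * M) with ha
  have ha0 : 0 < a := by positivity
  set μ := (Measure.pi fun _ : Fin n => nuP p) with hμ
  set P := ENNReal.ofReal p with hP
  set I := ∫⁻ x, (ENNReal.ofReal (p - kthLargest x l))⁻¹ ∂μ with hI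
  -- bound on I
  have hIb : I ≤ ENNReal.ofReal (M / p * p ^ n) := by
    have := inv_moment h1 h2 p
    have hl0 : ((l - 1 : ℕ) : ENNReal) ≠ 0 := by
      exact_mod_cast (by omega : l - 1 ≠ 0)
    have hlt : ((l - 1 : ℕ) : ENNReal) ≠ ⊤ := ENNReal.natCast_ne_top _
    rw [← ENNReal.mul_le_mul_iff_right hl0 hlt]
    refine this.trans (le_of_eq ?_)
    rw [← ENNReal.ofReal_natCast, ← ENNReal.ofReal_natCast, ← ENNReal.ofReal_pow hp.le,
      ← ENNReal.ofReal_mul (by positivity), ← ENNReal.ofReal_mul (by positivity)]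
    congr 1
    rw [Nat.cast_sub (by omega), hM]
    obtain ⟨k, rfl⟩ : ∃ k, n = k + 1 := ⟨n - 1, by omega⟩
    simp only [Nat.add_sub_cancel, Nat.cast_one]
    field_simp
    ring
  have hpt : ∀ᵐ x ∂μ, ENNReal.ofReal (2 * a) ≤
      ENNReal.ofReal ((p - kthLargest x l) / (1 - kthLargest x l)) +
      (ENNReal.ofReal (a ^ 2) +
        ENNReal.ofReal (a ^ 2 * (1 - p)) * (ENNReal.ofReal (p - kthLargest x l))⁻¹) := by
    filter_upwards [ae_box p n] with x hx
    have hY : kthLargest x l ≤ p := kth_le (by omega) h2 x p fun j => (hx j).2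
    set Y := kthLargest x l
    rcases hY.eq_or_lt with h | h
    · have : ENNReal.ofReal (a ^ 2 * (1 - p)) ≠ 0 := by
        simp only [ne_eq, ENNReal.ofReal_eq_zero, not_le]; positivity
      simp [h, ENNReal.mul_top this]
    · have hT : 0 < p - Y := by linarith
      have hY1 : 0 < 1 - Y := by linarith
      rw [← ENNReal.ofReal_inv_of_pos hT, ← ENNReal.ofReal_mul (by positivity),
        ← ENNReal.ofReal_add (by positivity) (by positivity),
        ← ENNReal.ofReal_add (by positivity) (by positivity)]
      apply ENNReal.ofReal_le_ofReal
      have e : (p - Y) / (1 - Y) + (a ^ 2 + a ^ 2 * (1 - p) * (p - Y)⁻¹) - 2 * a =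
          ((p - Y) - a * (1 - Y)) ^ 2 / ((1 - Y) * (p - Y)) := by
        field_simp
        ring
      have : 0 ≤ ((p - Y) - a * (1 - Y)) ^ 2 / ((1 - Y) * (p - Y)) := by positivity
      linarith
  have hInt := lintegral_mono_ae hpt
  have hm1 : Measurable fun x : Fin n → ℝ => (ENNReal.ofReal (p - kthLargest x l))⁻¹ :=
    (measurable_const.sub hmk).ennreal_ofReal.inv
  rw [lintegral_add_right _ ((hm1.const_mul _).const_add _), lintegral_add_left measurable_const,
    lintegral_const_mul _ hm1, lintegral_const, lintegral_const, hμ, pi_nuP_univ, ← hμ, ← hI] at hInt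
  set J := ∫⁻ x, ENNReal.ofReal ((p - kthLargest x l) / (1 - kthLargest x l)) ∂μ
  have h3 : ENNReal.ofReal (a ^ 2) * ENNReal.ofReal p ^ n + ENNReal.ofReal (a ^ 2 * (1 - p)) * I ≤
      ENNReal.ofReal (a * p ^ n) := by
    calc _ ≤ ENNReal.ofReal (a ^ 2) * ENNReal.ofReal p ^ n +
          ENNReal.ofReal (a ^ 2 * (1 - p)) * ENNReal.ofReal (M / p * p ^ n) := by gcongr
      _ = _ := by
        rw [← ENNReal.ofReal_pow hp.le, ← ENNReal.ofReal_mul (by positivity),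
          ← ENNReal.ofReal_mul (by positivity), ← ENNReal.ofReal_add (by positivity) (by positivity)]
        congr 1
        have : a * (p + (1 - p) * M) = p := by rw [ha]; field_simp
        have e : a ^ 2 * p ^ n + a ^ 2 * (1 - p) * (M / p * p ^ n) =
          a * p ^ n * (a * (p + (1 - p) * M)) / p := by field_simp
        rw [e, this]; field_simp
  have h4 : ENNReal.ofReal (a * p ^ n) + ENNReal.ofReal (a * p ^ n) ≤
      J + ENNReal.ofReal (a * p ^ n) := by
    refine le_trans (le_of_eq ?_) (hInt.trans (by gcongr))
    rw [← ENNReal.ofReal_pow hp.le, ← ENNReal.ofReal_mul (by positivity),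
      ← ENNReal.ofReal_add (by positivity) (by positivity)]
    congr 1; ring
  have h5 := (ENNReal.add_le_add_iff_right ENNReal.ofReal_ne_top).1 h4
  refine le_trans ?_ h5
  rw [hP, ← ENNReal.ofReal_pow hp.le]
  apply ENNReal.ofReal_le_ofReal
  rw [pow_add, mul_comm]
  have := real_ineq p M c hp hp1.le hM0 hc hcb
  gcongr

lemma unif_Iic (p : ℝ) (hp1 : p ≤ 1) : unif (Set.Iic p) = ENNReal.ofReal p := by
  rw [unif, Measure.restrict_apply measurableSet_Iic]
  have : Set.Iic p ∩ Set.Icc 0 1 = Set.Icc 0 p := by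
    ext u; simp only [Set.mem_inter_iff, Set.mem_Iic, Set.mem_Icc]
    constructor
    · rintro ⟨h, h', _⟩; exact ⟨h', h⟩
    · rintro ⟨h, h'⟩; exact ⟨h', h, h'.trans hp1⟩
  rw [this, Real.volume_Icc, sub_zero]

lemma unif_eq : unif = nuP 1 := rfl

lemma unif_restrict (p : ℝ) (hp1 : p ≤ 1) : unif.restrict (Set.Icc 0 p) = nuP p := by
  rw [unif, nuP, Measure.restrict_restrict measurableSet_Icc,
    Set.inter_eq_left.2 (Set.Icc_subset_Icc_right hp1)]

instance (n c : ℕ) : IsProbabilityMeasure (P₀ n c) := by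
  unfold P₀; infer_instance

lemma lower {n l c : ℕ} (h1 : 2 ≤ l) (h2 : l ≤ n) (hc : 1 ≤ c)
    (hcb : (n : ℝ) / ((l : ℝ) - 1) ≤ c) (p : ℝ) (hp : 0 < p) (hp1 : p < 1)
    (hA : MeasurableSet {ω : (Fin n → ℝ) × ℝ × (Fin c → ℝ) |
          max (kthLargest ω.1 1) (Wvar l ω.1 ω.2.1) ≤ p}) :
    ENNReal.ofReal p ^ (n + c) ≤ P₀ n c {ω : (Fin n → ℝ) × ℝ × (Fin c → ℝ) |
          max (kthLargest ω.1 1) (Wvar l ω.1 ω.2.1) ≤ p} := by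
  refine (main_int h1 h2 hc hcb p hp hp1).trans ?_
  rw [P₀, Measure.prod_apply hA]
  have hr : (Measure.pi fun _ : Fin n => nuP p) =
      (Measure.pi fun _ : Fin n => unif).restrict (Set.univ.pi fun _ => Set.Icc 0 p) := by
    rw [Measure.restrict_pi_pi]
    simp only [unif_restrict p hp1.le]
  refine le_trans ?_ (setLIntegral_le_lintegral (Set.univ.pi fun _ => Set.Icc 0 p) _)
  rw [← hr]
  apply lintegral_mono_ae
  filter_upwards [ae_box p n] with x hx
  have hY : kthLargest x l ≤ p := kth_le (by omega) h2 x p fun j => (hx j).2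
  have hX : kthLargest x 1 ≤ p := kth_le le_rfl (by omega) x p fun j => (hx j).2
  have hY1 : 0 < 1 - kthLargest x l := by linarith
  have hh1 : (p - kthLargest x l) / (1 - kthLargest x l) ≤ 1 := by
    rw [div_le_one hY1]; linarith
  rw [← unif_Iic _ hh1]
  calc _ = (unif.prod (Measure.pi fun _ : Fin c => unif))
        (Set.Iic ((p - kthLargest x l) / (1 - kthLargest x l)) ×ˢ Set.univ) := by
        rw [Measure.prod_prod]; simp
    _ ≤ _ := by
      apply measure_mono
      rintro ⟨u, z⟩ ⟨hu, -⟩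
      simp only [Set.mem_Iic] at hu
      simp only [Set.mem_preimage, Set.mem_ofPred_eq, max_le_iff]
      refine ⟨hX, ?_⟩
      rw [le_div_iff₀ hY1] at hu
      unfold Wvar
      linarith

lemma upper {n c : ℕ} (hn : 1 ≤ n) (hc : 1 ≤ c) (p : ℝ) (hp1 : p ≤ 1) :
    P₀ n c {ω : (Fin n → ℝ) × ℝ × (Fin c → ℝ) |
          max (kthLargest ω.1 1) (kthLargest ω.2.2 1) ≤ p} ≤ ENNReal.ofReal p ^ (n + c) := by
  calc _ ≤ P₀ n c ((Set.univ.pi fun _ => Set.Iic p) ×ˢ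
        (Set.univ ×ˢ (Set.univ.pi fun _ => Set.Iic p))) := by
        apply measure_mono
        rintro ⟨x, u, z⟩ h
        simp only [Set.mem_ofPred_eq, max_le_iff] at h
        exact ⟨fun j _ => (le_kth_one hn x j).trans h.1, trivial,
          fun j _ => (le_kth_one hc z j).trans h.2⟩
    _ = _ := by
        rw [P₀, Measure.prod_prod, Measure.prod_prod, Measure.pi_pi, Measure.pi_pi]
        simp [unif_Iic p hp1, pow_add]

lemma one_null {n l c : ℕ} (h1 : 2 ≤ l) (h2 : l ≤ n) :
    P₀ n c {ω : (Fin n → ℝ) × ℝ × (Fin c → ℝ) |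
          1 < max (kthLargest ω.1 1) (Wvar l ω.1 ω.2.1)} = 0 := by
  have hx : ∀ᵐ ω ∂(P₀ n c), ∀ j, 0 ≤ ω.1 j ∧ ω.1 j ≤ 1 :=
    Measure.quasiMeasurePreserving_fst.ae (ae_box 1 n)
  have hu0 : ∀ᵐ u ∂unif, u ∈ Set.Icc (0:ℝ) 1 :=
    ae_restrict_mem measurableSet_Icc
  have hu : ∀ᵐ ω ∂(P₀ n c), ω.2.1 ∈ Set.Icc (0:ℝ) 1 :=
    Measure.quasiMeasurePreserving_snd.ae (Measure.quasiMeasurePreserving_fst.ae hu0)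
  have : ∀ᵐ ω ∂(P₀ n c), ¬ (1 < max (kthLargest ω.1 1) (Wvar l ω.1 ω.2.1)) := by
    filter_upwards [hx, hu] with ω hx hu
    rw [not_lt, max_le_iff]
    refine ⟨kth_le le_rfl (by omega) _ _ fun j => (hx j).2, ?_⟩
    have := kth_le (by omega) h2 ω.1 1 fun j => (hx j).2
    unfold Wvar
    nlinarith [hu.2]
  rw [ae_iff] at this
  simpa only [not_not] using this

/-- If `n ≥ 1`, `2 ≤ ℓ ≤ n` and `c ≥ 1` with `c ≥ 4n/(ℓ-1)`, then
`X_S(n,c) = max (X_{(1),n}) (Z_{(1),c})` stochastically dominates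
`X_B(n,ℓ) = max (X_{(1),n}) (W_{ℓ,n})`. -/
theorem stmt0 (n ℓ c : ℕ) (hn : 1 ≤ n) (hℓ2 : 2 ≤ ℓ) (hℓn : ℓ ≤ n) (hc : 1 ≤ c)
    (hcb : (4 * n : ℝ) / ((ℓ : ℝ) - 1) ≤ (c : ℝ)) :
    ∀ p ∈ Set.Icc (0 : ℝ) 1,
      P₀ n c {ω : (Fin n → ℝ) × ℝ × (Fin c → ℝ) |
          p < max (kthLargest ω.1 1) (Wvar ℓ ω.1 ω.2.1)} ≤
      P₀ n c {ω : (Fin n → ℝ) × ℝ × (Fin c → ℝ) |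
          p < max (kthLargest ω.1 1) (kthLargest ω.2.2 1)} := by
  intro p hp
  have hm1 := meas_kth le_rfl hn
  have hmc := meas_kth le_rfl hc
  have hml := meas_kth (by omega : 1 ≤ ℓ) hℓn
  have hA : MeasurableSet {ω : (Fin n → ℝ) × ℝ × (Fin c → ℝ) |
          max (kthLargest ω.1 1) (Wvar ℓ ω.1 ω.2.1) ≤ p} := by
    refine measurableSet_le (Measurable.max (hm1.comp measurable_fst) ?_) measurable_const
    have hl : Measurable fun ω : (Fin n → ℝ) × ℝ × (Fin c → ℝ) => kthLargest ω.1 ℓ :=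
      hml.comp measurable_fst
    exact hl.add ((measurable_fst.comp measurable_snd).mul (measurable_const.sub hl))
  have hB : MeasurableSet {ω : (Fin n → ℝ) × ℝ × (Fin c → ℝ) |
          max (kthLargest ω.1 1) (kthLargest ω.2.2 1) ≤ p} :=
    measurableSet_le (Measurable.max (hm1.comp measurable_fst)
      (hmc.comp (measurable_snd.comp measurable_snd))) measurable_const
  rcases hp.2.eq_or_lt with rfl | hp1
  · rw [one_null hℓ2 hℓn]; exact zero_le
  have key : P₀ n c {ω : (Fin n → ℝ) × ℝ × (Fin c → ℝ) |
          max (kthLargest ω.1 1) (kthLargest ω.2.2 1) ≤ p} ≤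
      P₀ n c {ω : (Fin n → ℝ) × ℝ × (Fin c → ℝ) |
          max (kthLargest ω.1 1) (Wvar ℓ ω.1 ω.2.1) ≤ p} := by
    refine (upper hn hc p hp.2).trans ?_
    rcases hp.1.eq_or_lt with rfl | hp0
    · have : n + c ≠ 0 := by omega
      rw [ENNReal.ofReal_zero, zero_pow this]
      exact zero_le
    · refine lower hℓ2 hℓn hc (le_trans ?_ hcb) p hp0 hp1 hA
      have : (2 : ℝ) ≤ ℓ := by exact_mod_cast hℓ2
      have hn0 : (0 : ℝ) ≤ n := by positivity
      gcongr
      · linarith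
      · linarith
  have hA' := prob_compl_eq_one_sub (μ := P₀ n c) hA
  have hB' := prob_compl_eq_one_sub (μ := P₀ n c) hB
  simp only [Set.compl_ofPred, not_le] at hA' hB'
  rw [hA', hB']
  exact tsub_le_tsub_left key 1
end

section
/- Let 2 ≤ ℓ ≤ n be integers and define H_{ℓ,n}(p) := Pr[W_{ℓ,n} > p and X_{(1),n} < p] for p ∈ (0,1). Then H_{ℓ,n} is differentiable on (0,1) and for every p ∈ (0,1), H'_{ℓ,n}(p) = n · Pr[W_{ℓ−1,n−1} > p and X_{(1),n−1} < p] − H_{ℓ,n}(p)/(1 − p). -/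
open MeasureTheory Set

/-- `H k j p = Pr[W_{j,k} > p ∧ X_{(1),k} < p]`, where `X_1,…,X_k` are i.i.d. uniform on
`[0,1]` and, conditioned on them, `W_{j,k}` is uniform on `[X_{(j),k}, 1]`. -/
noncomputable def H (k j : ℕ) (p : ℝ) : ℝ :=
  (((Measure.pi fun _ : Fin k => unif).prod unif)
    {ω : (Fin k → ℝ) × ℝ | p < Wvar j ω.1 ω.2 ∧ kthLargest ω.1 1 < p}).toReal


lemma kth_insert {m : ℕ} (i : Fin (m+1)) (y : ℝ) (x : Fin m → ℝ) (h : ∀ j, x j < y) (l : ℕ)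
    (hl : 2 ≤ l) (hlm : l ≤ m + 1) :
    kthLargest (i.insertNth (α := fun _ => ℝ) y x) l = kthLargest x (l - 1) := by
  set z : Fin (m+1) → ℝ := i.insertNth (α := fun _ => ℝ) y x
  let σ : Equiv.Perm (Fin (m+1)) := (finSuccEquiv' (Fin.last m)).trans
    ((Equiv.optionCongr (Tuple.sort x)).trans (finSuccEquiv' i).symm)
  have h1 : ∀ k : Fin m, z (σ k.castSucc) = x (Tuple.sort x k) := by
    intro k
    have := finSuccEquiv'_succAbove (Fin.last m) k
    rw [Fin.succAbove_last] at this
    simp [σ, z, this]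
  have h2 : z (σ (Fin.last m)) = y := by
    simp [σ, z]
  have hm : Monotone (z ∘ σ) := by
    intro a b hab
    induction b using Fin.lastCases with
    | last =>
      induction a using Fin.lastCases with
      | last => exact le_rfl
      | cast a => simp only [Function.comp, h1, h2]; exact (h _).le
    | cast b =>
      induction a using Fin.lastCases with
      | last => exact absurd hab (by simp [Fin.le_def])
      | cast a =>
        simp only [Function.comp, h1]
        exact Tuple.monotone_sort x (by simpa using hab)
  have := Tuple.comp_sort_eq_comp_iff_monotone.2 hm
  have e1 : m + 1 - l < m + 1 := by omega
  have e2 : m - (l - 1) < m := by omega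
  unfold kthLargest
  rw [dif_pos e1, dif_pos e2, ← h1]
  have := congrFun this ⟨m+1-l, e1⟩
  simp only [Function.comp] at this
  rw [← this]
  congr 2
  ext; simp; omega

lemma kth_eq {n : ℕ} (x : Fin n → ℝ) (k : ℕ) (h1 : 1 ≤ k) (hk : k ≤ n) :
    kthLargest x k = x (Tuple.sort x ⟨n - k, by omega⟩) := by
  unfold kthLargest; rw [dif_pos]

lemma kth_one_lt {n : ℕ} (hn : 1 ≤ n) (x : Fin n → ℝ) (p : ℝ) :
    kthLargest x 1 < p ↔ ∀ i, x i < p := by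
  rw [kth_eq x 1 le_rfl hn]
  constructor
  · intro h i
    refine lt_of_le_of_lt ?_ h
    have := Tuple.monotone_sort x (a := (Tuple.sort x).symm i) (b := ⟨n - 1, by omega⟩)
      (by rw [Fin.le_def]; simp; omega)
    simpa using this
  · intro h; exact h _

lemma kth_lt {n : ℕ} (k : ℕ) (h1 : 1 ≤ k) (hk : k ≤ n) (x : Fin n → ℝ) (p : ℝ)
    (h : ∀ i, x i < p) : kthLargest x k < p := by
  rw [kth_eq x k h1 hk]; exact h _

lemma kth_meas {n : ℕ} (k : ℕ) : Measurable (fun x : Fin n → ℝ => kthLargest x k) := by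
  by_cases hh : n - k < n
  · refine measurable_of_Iic fun a => ?_
    have : (fun x : Fin n → ℝ => kthLargest x k) ⁻¹' Iic a =
        ⋃ σ : Equiv.Perm (Fin n), {x | Monotone (x ∘ σ) ∧ x (σ ⟨n-k, hh⟩) ≤ a} := by
      ext x
      simp only [kthLargest, dif_pos hh, mem_preimage, mem_Iic, mem_iUnion, mem_ofPred_eq]
      constructor
      · intro h; exact ⟨_, Tuple.monotone_sort x, h⟩
      · rintro ⟨σ, hσ, h⟩
        have := congrFun (Tuple.comp_sort_eq_comp_iff_monotone.2 hσ) ⟨n-k, hh⟩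
        simp only [Function.comp] at this
        rwa [← this]
    rw [this]
    refine MeasurableSet.iUnion fun σ => ?_
    refine MeasurableSet.inter ?_ (measurableSet_le (measurable_pi_apply _) measurable_const)
    have : {x : Fin n → ℝ | Monotone (x ∘ σ)} = ⋂ i, ⋂ j, ⋂ (_ : i ≤ j), {x | x (σ i) ≤ x (σ j)} := by
      ext x; simp [Monotone]
    change MeasurableSet {x : Fin n → ℝ | Monotone (x ∘ σ)}
    rw [this]
    exact MeasurableSet.iInter fun i => MeasurableSet.iInter fun j => MeasurableSet.iInter fun _ =>
      measurableSet_le (measurable_pi_apply _) (measurable_pi_apply _)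
  · simp [kthLargest, hh]

/-- All draws are below `p`. -/
def box (k : ℕ) (p : ℝ) : Set (Fin k → ℝ) := {x | ∀ i, x i < p}

/-- The integrand. -/
noncomputable def Fint {k : ℕ} (j : ℕ) (x : Fin k → ℝ) : ENNReal :=
  ENNReal.ofReal (1 - kthLargest x j)⁻¹

/-- The normalised probability. -/
noncomputable def gg (k j : ℕ) (p : ℝ) : ENNReal :=
  ∫⁻ x in box k p, Fint j x ∂(Measure.pi fun _ : Fin k => unif)

lemma box_meas (k : ℕ) (p : ℝ) : MeasurableSet (box k p) := by
  have : box k p = ⋂ i, {x | x i < p} := by ext; simp [box]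
  rw [this]
  exact MeasurableSet.iInter fun i => measurableSet_lt (measurable_pi_apply _) measurable_const

lemma Fint_meas (k j : ℕ) : Measurable (Fint (k := k) j) :=
  ((measurable_const.sub (kth_meas j)).inv).ennreal_ofReal

lemma gg_mono (k j : ℕ) : Monotone (gg k j) := by
  intro a b hab
  exact lintegral_mono_set fun x hx i => (hx i).trans_le hab

lemma Fint_le {k j : ℕ} (h1 : 1 ≤ j) (hk : j ≤ k) {p : ℝ} (hp : p < 1) (x : Fin k → ℝ)
    (hx : x ∈ box k p) : Fint j x ≤ ENNReal.ofReal (1 - p)⁻¹ := by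
  have := kth_lt j h1 hk x p hx
  apply ENNReal.ofReal_le_ofReal
  apply inv_anti₀ <;> linarith

lemma gg_lt_top {k j : ℕ} (h1 : 1 ≤ j) (hk : j ≤ k) {p : ℝ} (hp : p < 1) : gg k j p < ⊤ := by
  refine lt_of_le_of_lt (setLIntegral_mono (g := fun _ => ENNReal.ofReal (1 - p)⁻¹) measurable_const
    (fun x hx => Fint_le h1 hk hp x hx)) ?_
  rw [setLIntegral_const]
  exact ENNReal.mul_lt_top ENNReal.ofReal_lt_top (measure_lt_top _ _)

instance : NullSingletonClass unif := by unfold unif; infer_instance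

lemma gg_cont {k j : ℕ} (h1 : 1 ≤ j) (hk : j ≤ k) {p : ℝ} (hp : p < 1) :
    ContinuousAt (gg k j) p := by
  have e : gg k j = fun q => ∫⁻ x, (box k q).indicator (Fint j) x ∂(Measure.pi fun _ : Fin k => unif) := by
    ext q; rw [lintegral_indicator (box_meas _ _)]; rfl
  rw [e]
  obtain ⟨r, hpr, hr⟩ := exists_between hp
  refine tendsto_lintegral_filter_of_dominated_convergence (fun _ => ENNReal.ofReal (1 - r)⁻¹)
    ?_ ?_ ?_ ?_
  · exact Filter.Eventually.of_forall fun q => (Fint_meas k j).indicator (box_meas k q)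
  · filter_upwards [Iio_mem_nhds hpr] with q hq
    refine Filter.Eventually.of_forall fun x => ?_
    by_cases hx : x ∈ box k q
    · rw [indicator_of_mem hx]
      exact Fint_le h1 hk hr x fun i => (hx i).trans hq
    · rw [indicator_of_notMem hx]; exact zero_le
  · simp
  · have : ∀ᵐ x ∂(Measure.pi fun _ : Fin k => unif), ∀ i, x i ≠ p := by
      rw [ae_all_iff]; intro i
      rw [ae_iff]
      simpa using Measure.pi_hyperplane (fun _ : Fin k => unif) i p
    filter_upwards [this] with x hx
    apply tendsto_const_nhds.congr'
    by_cases hb : x ∈ box k p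
    · have : ∀ᶠ q in nhds p, ∀ i, x i < q := by
        rw [Filter.eventually_all]; exact fun i => Ioi_mem_nhds (hb i)
      filter_upwards [this] with q hq
      rw [indicator_of_mem hb, indicator_of_mem (show x ∈ box k q from hq)]
    · have : ∃ i, p < x i := by
        by_contra! hc
        exact hb fun i => lt_of_le_of_ne (hc i) (hx i)
      obtain ⟨i, hi⟩ := this
      filter_upwards [Iio_mem_nhds hi] with q hq
      have hq' : q < x i := hq
      rw [indicator_of_notMem hb, indicator_of_notMem (fun hh : x ∈ box k q => ?_)]
      exact absurd (hh i) hq'.not_gt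

lemma tie_null {k : ℕ} : ∀ᵐ x ∂(Measure.pi fun _ : Fin k => unif), ∀ i j, i ≠ j → x i ≠ x j := by
  have : (Measure.pi fun _ : Fin k => unif) = volume.restrict (univ.pi fun _ => Icc 0 1) := by
    unfold unif
    rw [volume_pi, Measure.restrict_pi_pi]
  rw [this]
  apply ae_restrict_of_ae
  rw [ae_all_iff]; intro i
  rw [ae_all_iff]; intro j
  by_cases hij : i = j
  · simp [hij]
  let S : Submodule ℝ (Fin k → ℝ) :=
    LinearMap.ker (LinearMap.proj (R := ℝ) (φ := fun _ : Fin k => ℝ) i - LinearMap.proj j)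
  have hS : S ≠ ⊤ := by
    intro h
    have : (Pi.single i 1 : Fin k → ℝ) ∈ S := by rw [h]; trivial
    simp [S, Ne.symm hij] at this
  have h0 := Measure.addHaar_submodule (volume : Measure (Fin k → ℝ)) S hS
  rw [ae_iff]
  refine measure_mono_null ?_ h0
  intro x hx
  simp only [mem_ofPred_eq, ne_eq, not_forall, not_not] at hx
  obtain ⟨_, hx⟩ := hx
  simp [S, hx]

lemma gg_rec {m l : ℕ} (hl : 2 ≤ l) (hlm : l ≤ m + 1) (p : ℝ) :
    gg (m+1) l p = (m + 1) * ∫⁻ y in Iio p, gg m (l - 1) y ∂unif := by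
  let B : Fin (m+1) → Set (Fin (m+1) → ℝ) := fun i => {x | x i < p ∧ ∀ j, x (i.succAbove j) < x i}
  have hB : ∀ i, MeasurableSet (B i) := by
    intro i
    have : B i = {x | x i < p} ∩ ⋂ j, {x | x (i.succAbove j) < x i} := by ext; simp [B]
    rw [this]
    exact (measurableSet_lt (measurable_pi_apply _) measurable_const).inter
      (MeasurableSet.iInter fun j => measurableSet_lt (measurable_pi_apply _) (measurable_pi_apply _))
  have hd : Pairwise (Function.onFun Disjoint B) := by
    intro i j hij
    refine Set.disjoint_left.2 fun x hi hj => ?_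
    obtain ⟨a, ha⟩ := Fin.exists_succAbove_eq hij
    obtain ⟨b, hb⟩ := Fin.exists_succAbove_eq hij.symm
    have h1 := hi.2 b
    have h2 := hj.2 a
    rw [ha] at h2
    rw [hb] at h1
    exact lt_asymm h1 h2
  have hU : box (m+1) p =ᵐ[Measure.pi fun _ : Fin (m+1) => unif] ⋃ i, B i := by
    rw [Filter.eventuallyEq_set]
    filter_upwards [tie_null] with x hx
    rw [mem_iUnion]
    constructor
    · intro h
      obtain ⟨i, hi⟩ := Finite.exists_max x
      exact ⟨i, h i, fun j => lt_of_le_of_ne (hi _) (hx _ _ (Fin.succAbove_ne i j))⟩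
    · rintro ⟨i, hi, h⟩ j
      rcases eq_or_ne j i with rfl | hji
      · exact hi
      · obtain ⟨a, rfl⟩ := Fin.exists_succAbove_eq hji
        exact (h a).trans hi
  have key : ∀ i, ∫⁻ x in B i, Fint l x ∂(Measure.pi fun _ : Fin (m+1) => unif)
      = ∫⁻ y in Iio p, gg m (l - 1) y ∂unif := by
    intro i
    rw [← lintegral_indicator (hB i)]
    have mp := measurePreserving_piFinSuccAbove (fun _ : Fin (m+1) => unif) i
    have := mp.symm.lintegral_comp ((Fint_meas (m+1) l).indicator (hB i))
    have hme : Measurable fun a : ℝ × (Fin m → ℝ) => (B i).indicator (Fint l)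
        ((MeasurableEquiv.piFinSuccAbove (fun _ => ℝ) i).symm a) :=
      ((Fint_meas (m+1) l).indicator (hB i)).comp (MeasurableEquiv.measurable _)
    rw [← this, lintegral_prod _ hme.aemeasurable, ← lintegral_indicator measurableSet_Iio]
    congr 1
    ext y
    by_cases hy : y < p
    · rw [indicator_of_mem (show y ∈ Iio p from hy)]
      unfold gg
      rw [← lintegral_indicator (box_meas _ _)]
      congr 1
      ext x
      have hz : (MeasurableEquiv.piFinSuccAbove (fun _ => ℝ) i).symm (y, x)
        = i.insertNth (α := fun _ => ℝ) y x := rfl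
      rw [hz]
      by_cases hx : x ∈ box m y
      · rw [indicator_of_mem hx, indicator_of_mem]
        · unfold Fint; rw [kth_insert i y x hx l hl hlm]
        · refine ⟨by simpa using hy, fun j => by simpa using hx j⟩
      · rw [indicator_of_notMem hx, indicator_of_notMem]
        intro h
        exact hx fun j => by simpa using h.2 j
    · rw [indicator_of_notMem (show y ∉ Iio p from hy)]
      rw [lintegral_eq_zero_iff']
      · refine Filter.Eventually.of_forall fun x => ?_
        apply indicator_of_notMem
        intro h
        have hz : (MeasurableEquiv.piFinSuccAbove (fun _ => ℝ) i).symm (y, x)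
          = i.insertNth (α := fun _ => ℝ) y x := rfl
        rw [hz] at h
        exact hy (by simpa using h.1)
      · exact (hme.comp measurable_prodMk_left).aemeasurable
  unfold gg
  rw [setLIntegral_congr hU, lintegral_iUnion hB hd, tsum_fintype]
  simp_rw [key]
  simp [gg]

lemma H_eq {k j : ℕ} (h1 : 1 ≤ j) (hk : j ≤ k) {p : ℝ} (hp : p < 1) :
    H k j p = (1 - p) * (gg k j p).toReal := by
  have hk1 : 1 ≤ k := h1.trans hk
  unfold H
  have hm : MeasurableSet {ω : (Fin k → ℝ) × ℝ | p < Wvar j ω.1 ω.2 ∧ kthLargest ω.1 1 < p} := by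
    have a : Measurable fun ω : (Fin k → ℝ) × ℝ => kthLargest ω.1 j := (kth_meas j).comp measurable_fst
    have b : Measurable fun ω : (Fin k → ℝ) × ℝ => kthLargest ω.1 1 := (kth_meas 1).comp measurable_fst
    have c : Measurable fun ω : (Fin k → ℝ) × ℝ => Wvar j ω.1 ω.2 :=
      a.add (measurable_snd.mul (measurable_const.sub a))
    exact (measurableSet_lt measurable_const c).inter (measurableSet_lt b measurable_const)
  rw [Measure.prod_apply hm]
  have : ∀ x : Fin k → ℝ, unif (Prod.mk x ⁻¹' {ω : (Fin k → ℝ) × ℝ | p < Wvar j ω.1 ω.2 ∧ kthLargest ω.1 1 < p})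
      = (box k p).indicator (fun x => ENNReal.ofReal (1 - p) * Fint j x) x := by
    intro x
    by_cases hx : x ∈ box k p
    · rw [indicator_of_mem hx]
      have ht := kth_lt j h1 hk x p hx
      unfold Fint
      have hmax := (kth_one_lt hk1 x p).2 hx
      set t := kthLargest x j with ht'
      have h1t : 0 < 1 - t := by linarith
      rw [← ENNReal.ofReal_mul (by linarith)]
      unfold unif
      have hs : (Prod.mk x ⁻¹' {ω : (Fin k → ℝ) × ℝ | p < Wvar j ω.1 ω.2 ∧ kthLargest ω.1 1 < p})
          = Ioi ((p - t) / (1 - t)) := by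
        ext u
        simp only [mem_preimage, mem_ofPred_eq, Wvar, mem_Ioi, ← ht', hmax, and_true]
        rw [div_lt_iff₀ h1t]
        constructor <;> intro <;> linarith
      have h0 : 0 ≤ (p - t) / (1 - t) := div_nonneg (by linarith) h1t.le
      have hi : Ioi ((p - t) / (1 - t)) ∩ Icc 0 1 = Ioc ((p - t) / (1 - t)) 1 := by
        ext u; simp only [mem_inter_iff, mem_Ioi, mem_Icc, mem_Ioc]
        constructor
        · rintro ⟨a, b, c⟩; exact ⟨a, c⟩
        · rintro ⟨a, c⟩; exact ⟨a, by linarith, c⟩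
      rw [hs, Measure.restrict_apply measurableSet_Ioi, hi, Real.volume_Ioc]
      congr 1
      field_simp
      ring
    · rw [indicator_of_notMem hx]
      convert measure_empty (μ := unif)
      ext u
      simp only [mem_preimage, mem_ofPred_eq, mem_empty_iff_false, iff_false, not_and]
      intro _ h
      exact hx ((kth_one_lt hk1 x p).1 h)
  simp_rw [this]
  rw [lintegral_indicator (box_meas _ _), lintegral_const_mul _ (Fint_meas k j), ENNReal.toReal_mul,
    ENNReal.toReal_ofReal (by linarith)]
  rfl

theorem stmt5 (n ℓ : ℕ) (hℓ : 2 ≤ ℓ) (hℓn : ℓ ≤ n) :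
    ∀ p ∈ Set.Ioo (0 : ℝ) 1,
      HasDerivAt (H n ℓ) ((n : ℝ) * H (n - 1) (ℓ - 1) p - H n ℓ p / (1 - p)) p := by
  rintro p ⟨hp0, hp1⟩
  obtain ⟨m, rfl⟩ : ∃ m, n = m + 1 := ⟨n - 1, by omega⟩
  have a1 : 1 ≤ ℓ - 1 := by omega
  have a2 : ℓ - 1 ≤ m := by omega
  set G : ℝ → ℝ := fun y => (gg m (ℓ - 1) y).toReal with hG
  have hmono : MonotoneOn G (Iio 1) := fun a _ b hb hab =>
    ENNReal.toReal_mono (gg_lt_top a1 a2 hb).ne (gg_mono _ _ hab)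
  have hcont : ContinuousOn G (Iio 1) := fun y hy =>
    ContinuousAt.continuousWithinAt
      ((ENNReal.tendsto_toReal (gg_lt_top a1 a2 hy).ne).comp (gg_cont a1 a2 hy))
  have hGint : IntervalIntegrable G volume 0 p := by
    refine (hmono.mono ?_).intervalIntegrable
    intro y hy
    rw [uIcc_of_le hp0.le] at hy
    exact hy.2.trans_lt hp1
  have hrep : ∀ q ∈ Ioo (0:ℝ) 1, (gg (m+1) ℓ q).toReal = (m + 1) * ∫ y in (0:ℝ)..q, G y := by
    rintro q ⟨hq0, hq1⟩
    rw [gg_rec hℓ hℓn, ENNReal.toReal_mul]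
    have hc : ((m : ENNReal) + 1).toReal = (m : ℝ) + 1 := by norm_cast
    rw [hc]
    congr 1
    rw [intervalIntegral.integral_of_le hq0.le, ← integral_Icc_eq_integral_Ioc,
      integral_Icc_eq_integral_Ico]
    have : unif.restrict (Iio q) = volume.restrict (Ico 0 q) := by
      unfold unif
      rw [Measure.restrict_restrict measurableSet_Iio]
      congr 1
      ext u; simp only [mem_inter_iff, mem_Iio, mem_Icc, mem_Ico]
      constructor
      · rintro ⟨a, b, c⟩; exact ⟨b, a⟩
      · rintro ⟨a, c⟩; exact ⟨c, a, by linarith⟩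
    rw [this, integral_toReal (gg_mono _ _).measurable.aemeasurable]
    filter_upwards [ae_restrict_mem measurableSet_Ico] with y hy
    exact gg_lt_top a1 a2 (hy.2.trans hq1)
  have hF := intervalIntegral.integral_hasDerivAt_right hGint
    (hcont.stronglyMeasurableAtFilter isOpen_Iio p hp1) (hcont.continuousAt (Iio_mem_nhds hp1))
  have hder := ((hasDerivAt_id p).const_sub 1).mul (hF.const_mul ((m:ℝ) + 1))
  have hE : H (m+1) ℓ =ᶠ[nhds p] fun q => (1 - q) * ((m + 1) * ∫ y in (0:ℝ)..q, G y) := by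
    filter_upwards [Ioo_mem_nhds hp0 hp1] with q hq
    rw [H_eq (by omega) hℓn hq.2, hrep q hq]
  have hfin := HasDerivAt.congr_of_eventuallyEq hder hE
  refine hfin.congr_deriv ?_
  rw [hE.eq_of_nhds, Nat.add_sub_cancel, H_eq a1 a2 hp1]
  have : 1 - p ≠ 0 := by linarith
  simp only [id, hG]
  push_cast
  field_simp
  ring
end

section
/- Let n ≥ 1 and m ≥ 2 be integers. Then n(m−1)/(n+m−2) + Σ_{i=1}^{m−2} n·i/((n+i)(n+i−1)) ≤ n·(1 + ln(1 + m/n)). -/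
theorem stmt10_aux (n : ℕ) (hn : 1 ≤ n) (k : ℕ) :
    ∑ i ∈ Finset.Icc 1 k,
        (n : ℝ) * (i : ℝ) / (((n : ℝ) + (i : ℝ)) * ((n : ℝ) + (i : ℝ) - 1)) ≤
    (n : ℝ) * (Real.log ((n : ℝ) + k) - Real.log n) := by
  have hn' : (1 : ℝ) ≤ n := by exact_mod_cast hn
  induction k with
  | zero => simp
  | succ k ih =>
    rw [Finset.sum_Icc_succ_top (by omega)]
    have hk : (0 : ℝ) ≤ k := Nat.cast_nonneg k
    have h0 : (0 : ℝ) < n + k := by linarith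
    have h1 : (0 : ℝ) < n + k + 1 := by linarith
    have hl := Real.log_le_sub_one_of_pos (div_pos h0 h1)
    rw [Real.log_div h0.ne' h1.ne'] at hl
    have e : ((n : ℝ) + k) / (n + k + 1) - 1 = - (1 / (n + k + 1)) := by
      field_simp; ring
    rw [e] at hl
    have h2 : (n : ℝ) * ((k : ℝ) + 1) / (((n : ℝ) + (k + 1)) * ((n : ℝ) + (k + 1) - 1))
        ≤ n * (1 / (n + k + 1)) := by
      rw [show (n : ℝ) + (k + 1) - 1 = n + k by ring, show (n : ℝ) + (k + 1) = n + k + 1 by ring,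
        mul_one_div, div_le_div_iff₀ (by positivity) h1]
      have : 0 ≤ (n : ℝ) * (n + k + 1) * (n - 1) :=
        mul_nonneg (by positivity) (by linarith)
      nlinarith
    have h3 : (n : ℝ) * (1 / (n + k + 1)) ≤ n * (Real.log (n + k + 1) - Real.log (n + k)) :=
      mul_le_mul_of_nonneg_left (by linarith) (by linarith)
    push_cast
    rw [show Real.log ((n : ℝ) + (k + 1)) = Real.log (n + k + 1) by rw [add_assoc]]
    linarith

/-- For integers `n ≥ 1` and `m ≥ 2`:
`n(m-1)/(n+m-2) + Σ_{i=1}^{m-2} n·i/((n+i)(n+i-1)) ≤ n·(1 + ln(1 + m/n))`. -/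
theorem stmt10 (n m : ℕ) (hn : 1 ≤ n) (hm : 2 ≤ m) :
    (n : ℝ) * ((m : ℝ) - 1) / ((n : ℝ) + (m : ℝ) - 2) +
      ∑ i ∈ Finset.Icc 1 (m - 2),
        (n : ℝ) * (i : ℝ) / (((n : ℝ) + (i : ℝ)) * ((n : ℝ) + (i : ℝ) - 1)) ≤
    (n : ℝ) * (1 + Real.log (1 + (m : ℝ) / (n : ℝ))) := by
  have hn' : (1 : ℝ) ≤ n := by exact_mod_cast hn
  have hm' : (2 : ℝ) ≤ m := by exact_mod_cast hm
  have h := stmt10_aux n hn (m - 2)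
  have h1 : (n : ℝ) * ((m : ℝ) - 1) / ((n : ℝ) + (m : ℝ) - 2) ≤ n := by
    rw [div_le_iff₀ (by linarith)]
    exact mul_le_mul_of_nonneg_left (by linarith) (by linarith)
  have h2 : Real.log (1 + (m : ℝ) / n) = Real.log (n + m) - Real.log n := by
    rw [← Real.log_div (by linarith) (by linarith)]
    congr 1
    field_simp
  have h3 : Real.log ((n : ℝ) + ((m - 2 : ℕ) : ℝ)) ≤ Real.log (n + m) := by
    rw [Nat.cast_sub hm]
    apply Real.log_le_log <;> push_cast <;> linarith
  have h4 := mul_le_mul_of_nonneg_left h3 (by linarith : (0 : ℝ) ≤ n)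
  rw [h2]
  linarith
end
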